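/- Let T^{(0)} ∈ ℝ^{N_0×N_0} be symmetric, and for c = 0, …, C−1 let P_c ∈ ℝ^{N_c×N_{c+1}} satisfy P_cᵀ·P_c = I with k ≤ N_{c+1} ≤ N_c; define recursively T^{(c+1)} = P_cᵀ·T^{(c)}·P_c. Suppose 0 < tol < 1/2 and that for each c = 0, …, C−1 there exists W_k^{(c)} ∈ ℝ^{N_c×k} with orthonormal columns consisting of eigenvectors of T^{(c)} belonging to its smallest k eigenvalues such that ‖W_k^{(c)} − P_c·P_cᵀ·W_k^{(c)}‖ ≤ 2·tol (spectral norm). Then Σ_{i=1}^{k} λ_i(T^{(C)}) − Σ_{i=1}^{k} λ_i(T^{(0)}) ≤ 4·k·C·(λ_max(T^{(0)}) − λ_min(T^{(0)}))·tol². -/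

import Mathlib

open Matrix

/-- The spectral (operator 2-) norm of a real matrix. -/
noncomputable def specNorm {α β : Type*} [Fintype α] [Fintype β] [DecidableEq β]
    (A : Matrix α β ℝ) : ℝ :=
  ‖LinearMap.toContinuousLinearMap (Matrix.toEuclideanLin A)‖

lemma aux_sum {n k : ℕ} (hk : k ≤ n) (l d : Fin n → ℝ) (hl : Monotone l)
    (h0 : ∀ i, 0 ≤ d i) (h1 : ∀ i, d i ≤ 1) (hs : ∑ i, d i = k) :
    ∑ i : Fin k, l (Fin.castLE hk i) ≤ ∑ i, l i * d i := by
  rcases Nat.eq_zero_or_pos k with rfl | hkp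
  · have hz : ∀ i, d i = 0 := by
      intro i
      have := (Finset.sum_eq_zero_iff_of_nonneg (fun i _ => h0 i)).1 (by simpa using hs)
      exact this i (Finset.mem_univ i)
    simp [hz]
  set a := l ⟨k - 1, by omega⟩ with ha
  have key : ∀ i : Fin n, (if (i : ℕ) < k then l i else 0) - a * (if (i : ℕ) < k then 1 else 0)
      ≤ l i * d i - a * d i := by
    intro i
    by_cases hi : (i : ℕ) < k
    · have h2 : l i ≤ a := hl (by rw [Fin.le_def]; simp; omega)
      simp only [hi, if_true]
      nlinarith [h1 i]
    · have h2 : a ≤ l i := hl (by rw [Fin.le_def]; simp; omega)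
      simp only [hi, if_false]
      nlinarith [h0 i]
  have conv : ∀ f : Fin n → ℝ, ∑ i : Fin n, (if (i : ℕ) < k then f i else 0)
      = ∑ i : Fin k, f (Fin.castLE hk i) := by
    intro f
    rw [← Finset.sum_filter]
    symm
    refine Finset.sum_bij (fun i _ => Fin.castLE hk i) ?_ ?_ ?_ ?_
    · intro i _; simp
    · intro i _ j _ h; simpa using h
    · intro b hb; exact ⟨⟨b, by simpa using hb⟩, by simp, by ext; simp⟩
    · intro i _; rfl
  have hsum := Finset.sum_le_sum (fun i (_ : i ∈ Finset.univ) => key i)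
  rw [Finset.sum_sub_distrib, Finset.sum_sub_distrib, ← Finset.mul_sum, ← Finset.mul_sum,
    conv l, conv (fun _ => 1), hs] at hsum
  simp at hsum
  linarith

lemma aux_kyfan {n k : ℕ} (hk : k ≤ n) (l : Fin n → ℝ) (hl : Monotone l)
    (U X : Matrix (Fin n) (Fin n) ℝ) (hU : Uᵀ * U = 1) (hX : Xᵀ = X) (hXX : X * X = X)
    (htr : X.trace = k) :
    ∑ i : Fin k, l (Fin.castLE hk i) ≤ (X * (U * diagonal l * Uᵀ)).trace := by
  have hU' : U * Uᵀ = 1 := mul_eq_one_comm.1 hU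
  set D := Uᵀ * X * U with hD
  have hDt : Dᵀ = D := by simp [hD, hX, Matrix.mul_assoc]
  have hDD : D * D = D := by
    calc D * D = Uᵀ * (X * (U * Uᵀ) * X) * U := by simp only [hD, Matrix.mul_assoc]
      _ = D := by rw [hU', Matrix.mul_one, hXX]
  have hdi : ∀ i, D i i = ∑ j, D i j ^ 2 := by
    intro i
    conv_lhs => rw [← hDD]
    rw [Matrix.mul_apply]
    refine Finset.sum_congr rfl fun j _ => ?_
    have : D j i = D i j := congrFun (congrFun hDt i) j
    rw [this, sq]
  have h0 : ∀ i, 0 ≤ D i i := fun i => by rw [hdi]; positivity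
  have h1 : ∀ i, D i i ≤ 1 := fun i => by
    have : D i i ^ 2 ≤ D i i := by
      conv_rhs => rw [hdi]
      exact Finset.single_le_sum (f := fun j => D i j ^ 2) (fun j _ => sq_nonneg _)
        (Finset.mem_univ i)
    nlinarith
  have hs : ∑ i, D i i = k := by
    rw [← htr]
    change D.trace = _
    rw [hD, Matrix.trace_mul_comm, ← Matrix.mul_assoc, hU', Matrix.one_mul]
  have := aux_sum hk l (fun i => D i i) hl h0 h1 hs
  refine this.trans (le_of_eq ?_)
  have e : (X * (U * diagonal l * Uᵀ)).trace = (diagonal l * D).trace := by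
    have e1 : X * (U * diagonal l * Uᵀ) = (X * U * diagonal l) * Uᵀ := by
      simp only [Matrix.mul_assoc]
    have e2 : Uᵀ * (X * U * diagonal l) = D * diagonal l := by
      simp only [hD, Matrix.mul_assoc]
    rw [e1, Matrix.trace_mul_comm, e2, Matrix.trace_mul_comm]
  rw [e]
  simp [Matrix.trace, Matrix.diagonal_mul]

lemma aux_step {n m k : ℕ} (hk : k ≤ m) (T : Matrix (Fin n) (Fin n) ℝ)
    (P : Matrix (Fin n) (Fin m) ℝ) (W : Matrix (Fin n) (Fin k) ℝ)
    (mu : Fin k → ℝ) (l : Fin m → ℝ) (hl : Monotone l) (U : Matrix (Fin m) (Fin m) ℝ)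
    (hU : Uᵀ * U = 1) (hT' : Pᵀ * T * P = U * diagonal l * Uᵀ)
    (hP : Pᵀ * P = 1) (hWW : Wᵀ * W = 1) (hTW : T * W = W * diagonal mu)
    (a b δ : ℝ) (hδ0 : 0 ≤ δ) (hδ : δ < 1)
    (hb : (b • (1 : Matrix (Fin n) (Fin n) ℝ) - T).PosSemidef)
    (ha : (T - a • (1 : Matrix (Fin n) (Fin n) ℝ)).PosSemidef)
    (hG : (Wᵀ * P * Pᵀ * W - (1 - δ) • (1 : Matrix (Fin k) (Fin k) ℝ)).PosSemidef) :
    ∑ i : Fin k, l (Fin.castLE hk i) ≤ ∑ i, mu i + k * (b - a) * δ := by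
  set G := Wᵀ * P * Pᵀ * W with hGdef
  have hGt : Gᵀ = G := by simp [hGdef, Matrix.mul_assoc]
  have hGpd : G.PosDef := by
    have h1 : ((1 - δ) • (1 : Matrix (Fin k) (Fin k) ℝ)).PosDef :=
      Matrix.PosDef.one.smul (by linarith)
    have := Matrix.PosDef.posSemidef_add hG h1
    simpa using this
  have hGu : IsUnit G.det := (Matrix.isUnit_iff_isUnit_det _).1 hGpd.isUnit
  have hGi : G * G⁻¹ = 1 := Matrix.mul_nonsing_inv _ hGu
  have hGi' : G⁻¹ * G = 1 := Matrix.nonsing_inv_mul _ hGu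
  have hGit : (G⁻¹)ᵀ = G⁻¹ := by rw [Matrix.transpose_nonsing_inv, hGt]
  set X := Pᵀ * W * G⁻¹ * (Wᵀ * P) with hX
  have hXt : Xᵀ = X := by simp [hX, hGit, Matrix.mul_assoc]
  have hXX : X * X = X := by
    calc X * X = Pᵀ * W * G⁻¹ * G * G⁻¹ * (Wᵀ * P) := by
          simp only [hX, hGdef, Matrix.mul_assoc]
      _ = X := by rw [Matrix.mul_assoc (Pᵀ * W) G⁻¹ G, hGi', Matrix.mul_one]
  have htr : X.trace = k := by
    rw [hX, Matrix.trace_mul_comm]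
    have : Wᵀ * P * (Pᵀ * W * G⁻¹) = G * G⁻¹ := by simp only [hGdef, Matrix.mul_assoc]
    rw [this, hGi]; simp
  have h1 := aux_kyfan hk l hl U X hU hXt hXX htr
  rw [← hT'] at h1
  refine h1.trans ?_
  set S := b • (1 : Matrix (Fin n) (Fin n) ℝ) - T with hS
  set Sg : Fin k → ℝ := fun i => b - mu i with hSg
  have hdg : diagonal Sg = b • (1 : Matrix (Fin k) (Fin k) ℝ) - diagonal mu := by
    ext i j; by_cases h : i = j
    · subst h; simp [hSg]
    · simp [h]
  have hSW : S * W = W * diagonal Sg := by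
    rw [hS, hdg, Matrix.sub_mul, Matrix.mul_sub, hTW]; simp
  have hSt : Sᵀ = S := by simpa [Matrix.IsHermitian] using hb.isHermitian
  have hWS : Wᵀ * S = diagonal Sg * Wᵀ := by
    have := congrArg Matrix.transpose hSW
    simpa [hSt] using this
  have hR : (S - W * diagonal Sg * Wᵀ).PosSemidef := by
    have h := hb.mul_mul_conjTranspose_same (1 - W * Wᵀ)
    convert h using 1
    simp only [conjTranspose_eq_transpose_of_trivial, transpose_sub, transpose_one,
      transpose_mul, transpose_transpose, Matrix.sub_mul, Matrix.mul_sub, Matrix.one_mul,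
      Matrix.mul_one]
    have e1 : S * (W * Wᵀ) = W * diagonal Sg * Wᵀ := by rw [← Matrix.mul_assoc, hSW]
    have e2 : W * Wᵀ * S = W * diagonal Sg * Wᵀ := by
      rw [Matrix.mul_assoc, hWS, Matrix.mul_assoc]
    have e3 : W * Wᵀ * S * (W * Wᵀ) = W * diagonal Sg * Wᵀ := by
      rw [e2]
      calc W * diagonal Sg * Wᵀ * (W * Wᵀ) = W * diagonal Sg * (Wᵀ * W) * Wᵀ := by
            simp only [Matrix.mul_assoc]
        _ = _ := by rw [hWW, Matrix.mul_one]
    rw [e3, e1, e2]; abel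
  set Y := P * X * Pᵀ with hY
  have hYt : Yᵀ = Y := by simp [hY, hXt, Matrix.mul_assoc]
  have hYY : Y * Y = Y := by
    calc Y * Y = P * (X * (Pᵀ * P) * X) * Pᵀ := by simp only [hY, Matrix.mul_assoc]
      _ = Y := by rw [hP, Matrix.mul_one, hXX]
  have hYtr : Y.trace = k := by
    rw [hY, Matrix.trace_mul_comm, ← Matrix.mul_assoc, hP, Matrix.one_mul, htr]
  have hYR : 0 ≤ (Y * (S - W * diagonal Sg * Wᵀ)).trace := by
    have h := (hR.mul_mul_conjTranspose_same Y).trace_nonneg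
    rw [conjTranspose_eq_transpose_of_trivial, hYt, Matrix.trace_mul_comm, ← Matrix.mul_assoc,
      hYY] at h
    exact h
  have hWYW : Wᵀ * Y * W = G := by
    calc Wᵀ * Y * W = G * G⁻¹ * G := by simp only [hY, hX, hGdef, Matrix.mul_assoc]
      _ = G := by rw [hGi, Matrix.one_mul]
  have hYW : (Y * (W * diagonal Sg * Wᵀ)).trace = ∑ i, Sg i * G i i := by
    have e1 : Y * (W * diagonal Sg * Wᵀ) = (Y * W * diagonal Sg) * Wᵀ := by
      simp only [Matrix.mul_assoc]
    have e2 : Wᵀ * (Y * W * diagonal Sg) = Wᵀ * Y * W * diagonal Sg := by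
      simp only [Matrix.mul_assoc]
    rw [e1, Matrix.trace_mul_comm, e2, hWYW, Matrix.trace_mul_comm]
    simp [Matrix.trace, Matrix.diagonal_mul]
  have hXT : (X * (Pᵀ * T * P)).trace = (Y * T).trace := by
    rw [← Matrix.mul_assoc, Matrix.trace_mul_comm, hY]
    simp only [Matrix.mul_assoc]
  have hYS : (Y * S).trace = k * b - (Y * T).trace := by
    rw [hS, Matrix.mul_sub, Matrix.trace_sub]; simp [hYtr, mul_comm]
  rw [Matrix.mul_sub, Matrix.trace_sub, hYW, hYS] at hYR
  have hGii : ∀ i, 1 - δ ≤ G i i := by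
    intro i
    have := hG.diag_nonneg (i := i)
    simp at this
    linarith
  have hWTW : Wᵀ * T * W = diagonal mu := by
    rw [Matrix.mul_assoc, hTW, ← Matrix.mul_assoc, hWW, Matrix.one_mul]
  have hmub : ∀ i, mu i ≤ b := by
    intro i
    have h := (hb.conjTranspose_mul_mul_same W).diag_nonneg (i := i)
    rw [conjTranspose_eq_transpose_of_trivial, hS, Matrix.mul_sub, Matrix.sub_mul, hWTW] at h
    simp [hWW] at h
    linarith
  have hmua : ∀ i, a ≤ mu i := by
    intro i
    have h := (ha.conjTranspose_mul_mul_same W).diag_nonneg (i := i)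
    rw [conjTranspose_eq_transpose_of_trivial, Matrix.mul_sub, Matrix.sub_mul, hWTW] at h
    simp [hWW] at h
    linarith
  rw [hXT]
  have hfin : ∑ i : Fin k, (b - mu i - (b - a) * δ) ≤ ∑ i, Sg i * G i i := by
    refine Finset.sum_le_sum fun i _ => ?_
    have h2 := mul_le_mul_of_nonneg_left (hGii i) (sub_nonneg.2 (hmub i))
    have h3 := mul_le_mul_of_nonneg_right (hmua i) hδ0
    simp only [hSg]
    nlinarith
  rw [Finset.sum_sub_distrib, Finset.sum_sub_distrib] at hfin
  simp at hfin
  linarith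

lemma aux_norm {n k : ℕ} (E : Matrix (Fin n) (Fin k) ℝ) (ε : ℝ)
    (h : specNorm E ≤ ε) :
    (ε ^ 2 • (1 : Matrix (Fin k) (Fin k) ℝ) - Eᵀ * E).PosSemidef := by
  refine Matrix.PosSemidef.of_dotProduct_mulVec_nonneg ?_ ?_
  · simp [Matrix.IsHermitian]
  · intro x
    have h1 := (LinearMap.toContinuousLinearMap (Matrix.toEuclideanLin E)).le_opNorm
      (WithLp.toLp 2 x)
    have h2 : ‖(WithLp.toLp 2 (E *ᵥ x) : EuclideanSpace ℝ (Fin n))‖ ≤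
        ε * ‖(WithLp.toLp 2 x : EuclideanSpace ℝ (Fin k))‖ :=
      h1.trans (mul_le_mul_of_nonneg_right h (norm_nonneg _))
    have h3 := pow_le_pow_left₀ (norm_nonneg _) h2 2
    rw [mul_pow, EuclideanSpace.norm_sq_eq, EuclideanSpace.norm_sq_eq] at h3
    have h4 : star x ⬝ᵥ ((ε ^ 2 • (1 : Matrix (Fin k) (Fin k) ℝ) - Eᵀ * E) *ᵥ x)
        = ε ^ 2 * (x ⬝ᵥ x) - (E *ᵥ x) ⬝ᵥ (E *ᵥ x) := by
      rw [Matrix.sub_mulVec, dotProduct_sub, ← Matrix.mulVec_mulVec,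
        Matrix.dotProduct_mulVec _ Eᵀ, Matrix.vecMul_transpose, Matrix.smul_mulVec]
      simp
    rw [h4]
    simp only [dotProduct, ← sq]
    simp only [Real.norm_eq_abs, sq_abs] at h3
    linarith

/-- Theorem 3.2, total loss from `C` compressions.
`T⁰` is symmetric; each compression step replaces `T^{(c)}` by
`T^{(c+1)} = P_cᵀ·T^{(c)}·P_c` with `P_c` having orthonormal columns; `lam c` lists the
sorted eigenvalues of `T^{(c)}`.  If each compression nearly preserves the orthonormal
eigenvectors `W_k^{(c)}` of the smallest `k` eigenvalues, namely
`‖W_k^{(c)} − P_c·P_cᵀ·W_k^{(c)}‖ ≤ 2·tol` with `0 < tol < 1/2`, then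
`Σ_{i<k} λ_i(T^{(C)}) − Σ_{i<k} λ_i(T^{(0)}) ≤ 4·k·C·(λ_max(T⁰) − λ_min(T⁰))·tol²`. -/
theorem ritz_value_loss_after_compressions
    {k C : ℕ} (N : ℕ → ℕ)
    (T : ∀ c, Matrix (Fin (N c)) (Fin (N c)) ℝ)
    (P : ∀ c, Matrix (Fin (N c)) (Fin (N (c + 1))) ℝ)
    (hN0 : 0 < N 0) (hk0 : k ≤ N 0)
    (hkc : ∀ c, c < C → k ≤ N (c + 1))
    (hNc : ∀ c, c < C → N (c + 1) ≤ N c)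
    (hT0 : (T 0)ᵀ = T 0)
    (hP : ∀ c, c < C → (P c)ᵀ * P c = 1)
    (hrec : ∀ c, c < C → T (c + 1) = (P c)ᵀ * T c * P c)
    (lam : ∀ c, Fin (N c) → ℝ)
    (hlam : ∀ c, c ≤ C → Monotone (lam c))
    (hdiag : ∀ c, c ≤ C → ∃ U : Matrix (Fin (N c)) (Fin (N c)) ℝ,
        Uᵀ * U = 1 ∧ T c = U * Matrix.diagonal (lam c) * Uᵀ)
    (tol : ℝ) (htol0 : 0 < tol) (htol1 : tol < 1 / 2)
    (hkC : k ≤ N C)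
    (hW : ∀ c, (hc : c < C) → ∃ W : Matrix (Fin (N c)) (Fin k) ℝ,
        Wᵀ * W = 1 ∧
        T c * W = W * Matrix.diagonal (fun i : Fin k =>
          lam c (Fin.castLE (by
            cases c with
            | zero => exact hk0
            | succ c' => exact hkc c' (by omega)) i)) ∧
        specNorm (W - P c * (P c)ᵀ * W) ≤ 2 * tol) :
    (∑ i : Fin k, lam C (Fin.castLE hkC i)) - (∑ i : Fin k, lam 0 (Fin.castLE hk0 i))
      ≤ 4 * (k : ℝ) * (C : ℝ) * (lam 0 ⟨N 0 - 1, by omega⟩ - lam 0 ⟨0, hN0⟩) * tol ^ 2 := by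
  have hmain : ∀ c, c ≤ C → ∀ hkc' : k ≤ N c,
      (lam 0 ⟨N 0 - 1, by omega⟩ • (1 : Matrix (Fin (N c)) (Fin (N c)) ℝ) - T c).PosSemidef ∧
      (T c - lam 0 ⟨0, hN0⟩ • (1 : Matrix (Fin (N c)) (Fin (N c)) ℝ)).PosSemidef ∧
      (∑ i : Fin k, lam c (Fin.castLE hkc' i)) - (∑ i : Fin k, lam 0 (Fin.castLE hk0 i))
      ≤ 4 * (k : ℝ) * (c : ℝ) * (lam 0 ⟨N 0 - 1, by omega⟩ - lam 0 ⟨0, hN0⟩) * tol ^ 2 := by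
    intro c
    induction c with
    | zero =>
      intro _ _
      obtain ⟨U, hU, hTU⟩ := hdiag 0 (Nat.zero_le _)
      have hU' : U * Uᵀ = 1 := mul_eq_one_comm.1 hU
      have hmono := hlam 0 (Nat.zero_le _)
      refine ⟨?_, ?_, by simp⟩
      · have h1 : (diagonal (fun i => lam 0 ⟨N 0 - 1, by omega⟩ - lam 0 i)).PosSemidef := by
          refine Matrix.PosSemidef.diagonal fun i => ?_
          exact sub_nonneg.2 (hmono (by rw [Fin.le_def]; simp; omega))
        have h2 := h1.mul_mul_conjTranspose_same U
        convert h2 using 1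
        rw [← Matrix.diagonal_sub, Matrix.mul_sub, Matrix.sub_mul,
          conjTranspose_eq_transpose_of_trivial, ← hTU, ← Matrix.smul_one_eq_diagonal]
        simp [hU']
      · have h1 : (diagonal (fun i => lam 0 i - lam 0 ⟨0, hN0⟩)).PosSemidef := by
          refine Matrix.PosSemidef.diagonal fun i => ?_
          exact sub_nonneg.2 (hmono (by rw [Fin.le_def]; simp))
        have h2 := h1.mul_mul_conjTranspose_same U
        convert h2 using 1
        rw [← Matrix.diagonal_sub, Matrix.mul_sub, Matrix.sub_mul,
          conjTranspose_eq_transpose_of_trivial, ← hTU, ← Matrix.smul_one_eq_diagonal]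
        simp [hU']
    | succ c ih =>
      intro hc hk'
      have hkN : k ≤ N c := hk'.trans (hNc c hc)
      obtain ⟨hb, ha, hsum⟩ := ih (by omega) hkN
      obtain ⟨U, hU, hTU⟩ := hdiag (c + 1) hc
      obtain ⟨W, hWW, hTW, hWn⟩ := hW c hc
      have hPP := hP c hc
      have hr := hrec c hc
      refine ⟨?_, ?_, ?_⟩
      · have h := hb.conjTranspose_mul_mul_same (P c)
        rw [conjTranspose_eq_transpose_of_trivial, Matrix.mul_sub, Matrix.sub_mul, ← hr] at h
        simpa [hPP] using h
      · have h := ha.conjTranspose_mul_mul_same (P c)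
        rw [conjTranspose_eq_transpose_of_trivial, Matrix.mul_sub, Matrix.sub_mul, ← hr] at h
        simpa [hPP] using h
      · have hE := aux_norm _ _ hWn
        have hEE : (W - P c * (P c)ᵀ * W)ᵀ * (W - P c * (P c)ᵀ * W)
            = 1 - Wᵀ * P c * (P c)ᵀ * W := by
          have e : Wᵀ * P c * (P c)ᵀ * (P c * (P c)ᵀ * W) = Wᵀ * P c * (P c)ᵀ * W := by
            calc _ = Wᵀ * P c * ((P c)ᵀ * P c) * (P c)ᵀ * W := by simp only [Matrix.mul_assoc]
              _ = _ := by rw [hPP, Matrix.mul_one]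
          have e' : (W - P c * (P c)ᵀ * W)ᵀ = Wᵀ - Wᵀ * P c * (P c)ᵀ := by
            simp [Matrix.mul_assoc]
          rw [e', Matrix.sub_mul, Matrix.mul_sub, Matrix.mul_sub, e, hWW]
          simp [Matrix.mul_assoc]
        rw [hEE] at hE
        have hstep := aux_step hk' (T c) (P c) W _ (lam (c + 1)) (hlam _ hc) U hU
          (hr ▸ hTU) hPP hWW hTW _ _ ((2 * tol) ^ 2) (by positivity) (by nlinarith) hb ha
          (by
            convert hE using 1
            rw [sub_smul, one_smul]; abel)
        push_cast
        linarith
  exact (hmain C le_rfl hkC).2.2
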